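/- Let (D,φ) be a nonnegative ℤ-flow on a signed graph (G,Σ). Then there exist signed circuits C₁,…,C_m (with proper orientations contained in D) and positive integers α₁,…,α_m such that φ = Σᵢ αᵢ χ_{Cᵢ}, where χ_C is the characteristic flow of the signed circuit C (value 1 on edges of a balanced circuit; value 1/2 on edges lying on the two unbalanced circuits of a barbell and value 1 on its connecting path; 0 elsewhere). -/

import Mathlib

open Finset

/-- A signed multigraph on vertex type `V` with edge type `E`:
each edge has an ordered pair of endpoints and a sign (`neg e = true` means negative). -/
structure SignedMultigraph (V E : Type) where
  ends : E → V × V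
  neg : E → Bool

namespace SignedMultigraph

variable {V E : Type} [Fintype V] [Fintype E] [DecidableEq V] [DecidableEq E]

/-- Degree of `v` in the edge subset `F` (loops count twice). -/
def degIn (G : SignedMultigraph V E) (F : Finset E) (v : V) : ℕ :=
  ∑ e ∈ F, ((if (G.ends e).1 = v then 1 else 0) + (if (G.ends e).2 = v then 1 else 0))

/-- Adjacency via an edge of `F`. -/
def adj (G : SignedMultigraph V E) (F : Finset E) (v w : V) : Prop :=
  ∃ e ∈ F, G.ends e = (v, w) ∨ G.ends e = (w, v)

/-- Vertices incident with an edge of `F`. -/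
def supp (G : SignedMultigraph V E) (F : Finset E) : Set V :=
  {v | ∃ e ∈ F, (G.ends e).1 = v ∨ (G.ends e).2 = v}

/-- Reachability using edges of `F`. -/
def reach (G : SignedMultigraph V E) (F : Finset E) : V → V → Prop :=
  Relation.ReflTransGen (G.adj F)

/-- `F` is (the edge set of) a circuit: nonempty, every vertex has degree 0 or 2,
and the support is connected. -/
def IsCircuit (G : SignedMultigraph V E) (F : Finset E) : Prop :=
  F.Nonempty ∧ (∀ v, G.degIn F v = 0 ∨ G.degIn F v = 2) ∧
    ∀ v ∈ G.supp F, ∀ w ∈ G.supp F, G.reach F v w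

/-- The negative edges inside `F`. -/
def negEdges (G : SignedMultigraph V E) (F : Finset E) : Finset E :=
  F.filter (fun e => G.neg e = true)

def IsBalancedCircuit (G : SignedMultigraph V E) (F : Finset E) : Prop :=
  G.IsCircuit F ∧ Even (G.negEdges F).card

def IsUnbalancedCircuit (G : SignedMultigraph V E) (F : Finset E) : Prop :=
  G.IsCircuit F ∧ Odd (G.negEdges F).card

/-- A signed graph is balanced if every circuit has an even number of negative edges. -/
def Balanced (G : SignedMultigraph V E) : Prop :=
  ∀ F : Finset E, G.IsCircuit F → Even (G.negEdges F).card

/-- `P` is the edge set of a path from `v₁` to `v₂` (trivial iff `v₁ = v₂`). -/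
def IsPathBetween (G : SignedMultigraph V E) (P : Finset E) (v₁ v₂ : V) : Prop :=
  if v₁ = v₂ then P = ∅ else
    G.degIn P v₁ = 1 ∧ G.degIn P v₂ = 1 ∧
    (∀ v, v ≠ v₁ → v ≠ v₂ → G.degIn P v = 0 ∨ G.degIn P v = 2) ∧
    ∀ v ∈ G.supp P, ∀ w ∈ G.supp P, G.reach P v w

/-- `F` is a barbell: two unbalanced circuits joined by a (possibly trivial) path. -/
def IsBarbell (G : SignedMultigraph V E) (F : Finset E) : Prop :=
  ∃ (C₁ C₂ P : Finset E) (v₁ v₂ : V),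
    G.IsUnbalancedCircuit C₁ ∧ G.IsUnbalancedCircuit C₂ ∧
    G.IsPathBetween P v₁ v₂ ∧ v₁ ∈ G.supp C₁ ∧ v₂ ∈ G.supp C₂ ∧
    F = C₁ ∪ C₂ ∪ P ∧
    (G.supp C₁ \ {v₁}) ∩ G.supp (C₂ ∪ P) = ∅ ∧
    (G.supp C₂ \ {v₂}) ∩ G.supp (C₁ ∪ P) = ∅

/-- A signed circuit is a balanced circuit or a barbell. -/
def IsSignedCircuit (G : SignedMultigraph V E) (F : Finset E) : Prop :=
  G.IsBalancedCircuit F ∨ G.IsBarbell F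

/-- A bidirection `d` assigns to each half-edge a direction (`true` = toward its endpoint);
it is an orientation of the signed graph if negative edges are exactly the
extroverted/introverted ones. -/
def IsOrientation (G : SignedMultigraph V E) (d : E → Bool × Bool) : Prop :=
  ∀ e, G.neg e = true ↔ (d e).1 = (d e).2

/-- Net inflow at vertex `v` (incoming half-edges count `+φ e`, outgoing `-φ e`). -/
def vertexSum {Γ : Type} [AddCommGroup Γ] (G : SignedMultigraph V E)
    (d : E → Bool × Bool) (φ : E → Γ) (v : V) : Γ :=
  ∑ e, ((if (G.ends e).1 = v then (if (d e).1 then φ e else -φ e) else 0) +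
        (if (G.ends e).2 = v then (if (d e).2 then φ e else -φ e) else 0))

/-- `(d, φ)` is a flow: `d` is an orientation and Kirchhoff's law holds at every vertex. -/
def IsFlow {Γ : Type} [AddCommGroup Γ] (G : SignedMultigraph V E)
    (d : E → Bool × Bool) (φ : E → Γ) : Prop :=
  G.IsOrientation d ∧ ∀ v, G.vertexSum d φ v = 0

/-- Nowhere-zero `Γ`-flow. -/
def HasNZGroupFlow (G : SignedMultigraph V E) (Γ : Type) [AddCommGroup Γ] : Prop :=
  ∃ (d : E → Bool × Bool) (φ : E → Γ), G.IsFlow d φ ∧ ∀ e, φ e ≠ 0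

/-- Flow-admissible: has a nowhere-zero integer flow. -/
def FlowAdmissible (G : SignedMultigraph V E) : Prop :=
  ∃ (d : E → Bool × Bool) (φ : E → ℤ), G.IsFlow d φ ∧ ∀ e, φ e ≠ 0

/-- Nowhere-zero `k`-flow: integer flow with `0 < |φ e| < k`. -/
def HasNZkFlow (G : SignedMultigraph V E) (k : ℤ) : Prop :=
  ∃ (d : E → Bool × Bool) (φ : E → ℤ), G.IsFlow d φ ∧ ∀ e, 0 < |φ e| ∧ |φ e| < k

/-- The flow number: least `k : ℕ` admitting a nowhere-zero `k`-flow. -/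
noncomputable def flowNum (G : SignedMultigraph V E) : ℕ :=
  sInf {k : ℕ | G.HasNZkFlow (k : ℤ)}

/-- Circular `t`-flow: real flow with `1 ≤ |φ e| ≤ t - 1`. -/
def HasCircularFlow (G : SignedMultigraph V E) (t : ℝ) : Prop :=
  ∃ (d : E → Bool × Bool) (φ : E → ℝ), G.IsFlow d φ ∧ ∀ e, 1 ≤ |φ e| ∧ |φ e| ≤ t - 1

/-- The circular flow number. -/
noncomputable def circFlowNum (G : SignedMultigraph V E) : ℝ :=
  sInf {t : ℝ | G.HasCircularFlow t}

/-- Bridgeless: the endpoints of each edge are joined by a path avoiding that edge. -/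
def Bridgeless (G : SignedMultigraph V E) : Prop :=
  ∀ e : E, G.reach (Finset.univ.erase e) (G.ends e).1 (G.ends e).2

/-- Switching at a vertex `v`. -/
def switch (G : SignedMultigraph V E) (v : V) : SignedMultigraph V E where
  ends := G.ends
  neg := fun e => xor (G.neg e) (xor (decide ((G.ends e).1 = v)) (decide ((G.ends e).2 = v)))

/-- Switching equivalence of signed graphs on the same underlying graph. -/
def Equivalent (G₁ G₂ : SignedMultigraph V E) : Prop :=
  Relation.ReflTransGen (fun H₁ H₂ => ∃ v : V, H₂ = H₁.switch v) G₁ G₂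

/-- Antibalanced: switching-equivalent to an all-negative signed graph. -/
def Antibalanced (G : SignedMultigraph V E) : Prop :=
  ∃ G' : SignedMultigraph V E, G.Equivalent G' ∧ ∀ e, G'.neg e = true

/-- No vertex of the support of `S` is a source or a sink of `d` restricted to `S`. -/
def NoSourceSink (G : SignedMultigraph V E) (d : E → Bool × Bool) (S : Finset E) : Prop :=
  ∀ v ∈ G.supp S,
    (∃ e ∈ S, ((G.ends e).1 = v ∧ (d e).1 = true) ∨ ((G.ends e).2 = v ∧ (d e).2 = true)) ∧
    (∃ e ∈ S, ((G.ends e).1 = v ∧ (d e).1 = false) ∨ ((G.ends e).2 = v ∧ (d e).2 = false))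

/-- Zero-sum `k`-flow on the underlying (unsigned) graph. -/
def ZeroSumFlow (G : SignedMultigraph V E) (k : ℤ) : Prop :=
  ∃ f : E → ℤ, (∀ e, 1 ≤ |f e| ∧ |f e| ≤ k - 1) ∧
    ∀ v : V, (∑ e, ((if (G.ends e).1 = v then f e else 0) +
                    (if (G.ends e).2 = v then f e else 0))) = 0

end SignedMultigraph
namespace SignedMultigraph

section Walks

variable {V E : Type} (G : SignedMultigraph V E) (d : E → Bool × Bool)

/-- The state at the start of the dart `a`. A dart is an edge with a direction of traversal
(`false` runs from the first end to the second); a state is a vertex together with a flag telling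
whether the traversal respects (`true`) or reverses (`false`) the bidirection `d`. -/
def src (a : E × Bool) : V × Bool :=
  if a.2 then ((G.ends a.1).2, !(d a.1).2) else ((G.ends a.1).1, !(d a.1).1)

/-- The state at the end of the dart `a`. -/
def tgt (a : E × Bool) : V × Bool :=
  if a.2 then ((G.ends a.1).1, (d a.1).1) else ((G.ends a.1).2, (d a.1).2)

/-- The opposite state at the same vertex. -/
def opp (x : V × Bool) : V × Bool := (x.1, !x.2)

/-- The same edge traversed backwards. -/
def revDart (a : E × Bool) : E × Bool := (a.1, !a.2)

@[simp] theorem opp_fst (x : V × Bool) : (opp x).1 = x.1 := rfl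

@[simp] theorem opp_opp (x : V × Bool) : opp (opp x) = x := by simp [opp]

theorem opp_ne (x : V × Bool) : opp x ≠ x := by
  intro h
  have := congrArg Prod.snd h
  simp [opp] at this

theorem eq_opp_of_ne {x y : V × Bool} (h : x.1 = y.1) (hne : x ≠ y) : x = opp y := by
  obtain ⟨v, s⟩ := x
  obtain ⟨w, t⟩ := y
  obtain rfl : v = w := h
  cases s <;> cases t <;> simp_all [opp]

@[simp] theorem src_revDart (a : E × Bool) : G.src d (revDart a) = opp (G.tgt d a) := by
  obtain ⟨e, b⟩ := a
  cases b <;> rfl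

@[simp] theorem tgt_revDart (a : E × Bool) : G.tgt d (revDart a) = opp (G.src d a) := by
  obtain ⟨e, b⟩ := a
  cases b <;> simp [revDart, src, tgt, opp]

theorem eq_or_eq_revDart {a b : E × Bool} (h : a.1 = b.1) : b = a ∨ b = revDart a := by
  obtain ⟨e, s⟩ := a
  obtain ⟨f, t⟩ := b
  obtain rfl : e = f := h
  cases s <;> cases t <;> simp [revDart]

/-- `W` is a walk from the state `x` to the state `y`. -/
def IsWalk : V × Bool → List (E × Bool) → V × Bool → Prop
  | x, [], y => x = y
  | x, a :: W, y => G.src d a = x ∧ IsWalk (G.tgt d a) W y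

/-- The states at the starts of the darts of `W`. -/
def states (W : List (E × Bool)) : List (V × Bool) := W.map (G.src d)

/-- The vertices at the starts of the darts of `W`. -/
def verts (W : List (E × Bool)) : List V := (G.states d W).map Prod.fst

variable {G d}

@[simp] theorem states_append (A B : List (E × Bool)) :
    G.states d (A ++ B) = G.states d A ++ G.states d B := by simp [states]

@[simp] theorem states_cons (a : E × Bool) (B : List (E × Bool)) :
    G.states d (a :: B) = G.src d a :: G.states d B := rfl

@[simp] theorem states_nil : G.states d [] = [] := rfl

@[simp] theorem verts_append (A B : List (E × Bool)) :
    G.verts d (A ++ B) = G.verts d A ++ G.verts d B := by simp [verts]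

@[simp] theorem verts_cons (a : E × Bool) (B : List (E × Bool)) :
    G.verts d (a :: B) = (G.src d a).1 :: G.verts d B := rfl

@[simp] theorem verts_nil : G.verts d [] = [] := rfl

theorem mem_verts_of_mem_states {W : List (E × Bool)} {x : V × Bool} (h : x ∈ G.states d W) :
    x.1 ∈ G.verts d W := List.mem_map_of_mem h

theorem mem_states_of_mem {W : List (E × Bool)} {a : E × Bool} (h : a ∈ W) :
    G.src d a ∈ G.states d W := List.mem_map_of_mem h

theorem exists_mem_states_of_mem_verts {W : List (E × Bool)} {v : V} (h : v ∈ G.verts d W) :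
    ∃ x ∈ G.states d W, x.1 = v := List.mem_map.1 h

theorem IsWalk.append {A B : List (E × Bool)} {x y z : V × Bool} (hA : G.IsWalk d x A y)
    (hB : G.IsWalk d y B z) : G.IsWalk d x (A ++ B) z := by
  induction A generalizing x with
  | nil => exact (show x = y from hA) ▸ hB
  | cons a A ih => exact ⟨hA.1, ih hA.2⟩

theorem IsWalk.exists_of_append {A B : List (E × Bool)} {x z : V × Bool}
    (h : G.IsWalk d x (A ++ B) z) : ∃ y, G.IsWalk d x A y ∧ G.IsWalk d y B z := by
  induction A generalizing x with
  | nil => exact ⟨x, rfl, h⟩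
  | cons a A ih =>
    obtain ⟨y, h1, h2⟩ := ih h.2
    exact ⟨y, ⟨h.1, h1⟩, h2⟩

theorem IsWalk.reverse {A : List (E × Bool)} {x y : V × Bool} (hA : G.IsWalk d x A y) :
    G.IsWalk d (opp y) (A.map revDart).reverse (opp x) := by
  induction A generalizing x with
  | nil => exact congrArg opp (show x = y from hA).symm
  | cons a A ih =>
    rw [List.map_cons, List.reverse_cons]
    refine (ih hA.2).append ⟨G.src_revDart d a, ?_⟩
    rw [← hA.1]
    exact G.tgt_revDart d a

theorem IsWalk.head_mem {A : List (E × Bool)} {x y : V × Bool} (hA : G.IsWalk d x A y)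
    (hne : A ≠ []) : ∃ a ∈ A, G.src d a = x := by
  cases A with
  | nil => exact absurd rfl hne
  | cons a A => exact ⟨a, List.mem_cons_self, hA.1⟩

theorem IsWalk.start_mem_states {A : List (E × Bool)} {x y : V × Bool} (hA : G.IsWalk d x A y)
    (hne : A ≠ []) : x ∈ G.states d A := by
  obtain ⟨a, ha, rfl⟩ := hA.head_mem hne
  exact mem_states_of_mem ha

theorem IsWalk.last_mem {A : List (E × Bool)} {x y : V × Bool} (hA : G.IsWalk d x A y)
    (hne : A ≠ []) : ∃ a ∈ A, G.tgt d a = y := by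
  induction A generalizing x with
  | nil => exact absurd rfl hne
  | cons a A ih =>
    cases A with
    | nil => exact ⟨a, List.mem_cons_self, hA.2⟩
    | cons b A =>
      obtain ⟨c, hc, h⟩ := ih hA.2 (List.cons_ne_nil _ _)
      exact ⟨c, List.mem_cons_of_mem _ hc, h⟩

theorem IsWalk.ne_nil {A : List (E × Bool)} {x y : V × Bool} (hA : G.IsWalk d x A y)
    (hne : x ≠ y) : A ≠ [] := by
  rintro rfl
  exact hne hA

/-- The end of a dart of a walk is the start of another dart or the end of the walk. -/
theorem IsWalk.tgt_mem {A : List (E × Bool)} {x y : V × Bool} (hA : G.IsWalk d x A y)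
    {a : E × Bool} (ha : a ∈ A) : G.tgt d a ∈ (G.states d A).tail ∨ G.tgt d a = y := by
  induction A generalizing x with
  | nil => simp at ha
  | cons b A ih =>
    rcases List.mem_cons.1 ha with rfl | ha
    · cases A with
      | nil => exact Or.inr hA.2
      | cons c A => exact Or.inl (by simp [hA.2.1])
    · exact (ih hA.2 ha).imp_left List.mem_of_mem_tail

/-- The start of a dart of a walk is the end of another dart or the start of the walk. -/
theorem IsWalk.src_mem {A : List (E × Bool)} {x y : V × Bool} (hA : G.IsWalk d x A y)
    {a : E × Bool} (ha : a ∈ A) : G.src d a = x ∨ ∃ b ∈ A, G.tgt d b = G.src d a := by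
  induction A generalizing x with
  | nil => simp at ha
  | cons b A ih =>
    rcases List.mem_cons.1 ha with rfl | ha
    · exact Or.inl hA.1
    · rcases ih hA.2 ha with h | ⟨c, hc, h⟩
      · exact Or.inr ⟨b, List.mem_cons_self, h.symm⟩
      · exact Or.inr ⟨c, List.mem_cons_of_mem _ hc, h⟩

/-- A walk can be cut at the first visit of a vertex. -/
theorem IsWalk.exists_split {W : List (E × Bool)} {x y : V × Bool} {u : V}
    (hW : G.IsWalk d x W y) (hu : u ∈ G.verts d W ++ [y.1]) :
    ∃ A B z, W = A ++ B ∧ G.IsWalk d x A z ∧ G.IsWalk d z B y ∧ z.1 = u ∧ u ∉ G.verts d A := by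
  induction W generalizing x with
  | nil =>
    obtain rfl : x = y := hW
    exact ⟨[], [], x, rfl, rfl, rfl, by simpa [eq_comm] using hu, by simp⟩
  | cons a W ih =>
    by_cases h : x.1 = u
    · exact ⟨[], a :: W, x, rfl, rfl, hW, h, by simp⟩
    · have h' : (G.src d a).1 ≠ u := by rwa [hW.1]
      obtain ⟨A, B, z, rfl, hA, hB, hz, huA⟩ := ih hW.2 (by
        rw [verts_cons, List.cons_append, List.mem_cons] at hu
        exact hu.resolve_left (Ne.symm h'))
      exact ⟨a :: A, B, z, rfl, ⟨hW.1, hA⟩, hB, hz, by simp [huA, Ne.symm h']⟩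

/-- A walk `L` that returns to its starting vertex with the opposite flag, visiting no vertex
twice. -/
def IsLeaf (G : SignedMultigraph V E) (d : E → Bool × Bool) (x : V × Bool)
    (L : List (E × Bool)) : Prop :=
  G.IsWalk d x L (opp x) ∧ (G.verts d L).Nodup

/-- A walk that repeats a vertex but no state contains a leaf. -/
theorem IsWalk.exists_leaf {W : List (E × Bool)} {x y : V × Bool} (hW : G.IsWalk d x W y)
    (hs : (G.states d W ++ [y]).Nodup) (hv : ¬ (G.verts d W ++ [y.1]).Nodup) :
    ∃ P L Q z, W = P ++ L ++ Q ∧ G.IsWalk d x P z ∧ G.IsLeaf d z L ∧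
      G.IsWalk d (opp z) Q y := by
  induction W generalizing x with
  | nil => simp at hv
  | cons a W ih =>
    by_cases h : (G.verts d W ++ [y.1]).Nodup
    · have hmem : (G.src d a).1 ∈ G.verts d W ++ [y.1] := by
        by_contra hn
        exact hv (List.nodup_cons.2 ⟨hn, h⟩)
      obtain ⟨A, B, z, rfl, hA, hB, hz, huA⟩ := hW.2.exists_split hmem
      have hz' : z ∈ G.states d (A ++ B) ++ [y] := by
        cases B with
        | nil =>
          obtain rfl : z = y := hB
          simp
        | cons b B => simp [hB.1]
      have hne : z ≠ G.src d a := by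
        rintro rfl
        exact (List.nodup_cons.1 hs).1 hz'
      obtain rfl := eq_opp_of_ne hz hne
      refine ⟨[], a :: A, B, G.src d a, by simp, hW.1.symm, ⟨⟨rfl, hA⟩, ?_⟩, hB⟩
      rw [verts_append, List.append_assoc] at h
      exact List.nodup_cons.2 ⟨huA, h.of_append_left⟩
    · obtain ⟨P, L, Q, z, rfl, hP, hL, hQ⟩ := ih hW.2 (List.nodup_cons.1 hs).2 h
      exact ⟨a :: P, L, Q, z, rfl, ⟨hW.1, hP⟩, hL, hQ⟩

/-- A walk that repeats a state contains a shorter closed walk. -/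
theorem IsWalk.exists_closed {W : List (E × Bool)} {x y : V × Bool} (hW : G.IsWalk d x W y)
    (hs : ¬ (G.states d W).Nodup) :
    ∃ A B C z, W = A ++ B ++ C ∧ G.IsWalk d x A z ∧ G.IsWalk d z B z ∧ G.IsWalk d z C y ∧
      B ≠ [] ∧ C ≠ [] := by
  induction W generalizing x with
  | nil => simp at hs
  | cons a W ih =>
    by_cases h : (G.states d W).Nodup
    · have hmem : G.src d a ∈ G.states d W := by
        by_contra hn
        exact hs (List.nodup_cons.2 ⟨hn, h⟩)
      obtain ⟨b, hb, hba⟩ := List.mem_map.1 hmem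
      obtain ⟨W₁, W₂, rfl⟩ := List.append_of_mem hb
      obtain ⟨y', h1, h2⟩ := hW.2.exists_of_append
      obtain rfl : G.src d a = y' := hba ▸ h2.1
      exact ⟨[], a :: W₁, b :: W₂, G.src d a, by simp, hW.1.symm, ⟨rfl, h1⟩, h2,
        List.cons_ne_nil _ _, List.cons_ne_nil _ _⟩
    · obtain ⟨A, B, C, z, rfl, hA, hB, hC, hne⟩ := ih hW.2 h
      exact ⟨a :: A, B, C, z, rfl, ⟨hW.1, hA⟩, hB, hC, hne⟩

/-- A walk that visits no vertex twice uses no edge twice. -/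
theorem IsWalk.edges_nodup {W : List (E × Bool)} {x y : V × Bool} (hW : G.IsWalk d x W y)
    (hv : (G.verts d W).Nodup) : (W.map Prod.fst).Nodup := by
  induction W generalizing x with
  | nil => simp
  | cons a W ih =>
    rw [verts_cons, List.nodup_cons] at hv
    rw [List.map_cons, List.nodup_cons]
    refine ⟨fun hmem => ?_, ih hW.2 hv.2⟩
    obtain ⟨b, hb, hab⟩ := List.mem_map.1 hmem
    rcases eq_or_eq_revDart hab.symm with rfl | rfl
    · exact hv.1 (mem_verts_of_mem_states (mem_states_of_mem hb))
    · cases W with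
      | nil => simp at hb
      | cons c W =>
        rcases List.mem_cons.1 hb with hbc | hb
        · have h1 := hW.2.1
          rw [← hbc, src_revDart] at h1
          exact opp_ne _ h1
        · refine (List.nodup_cons.1 hv.2).1 ?_
          have := mem_verts_of_mem_states (mem_states_of_mem (G := G) (d := d) hb)
          rwa [src_revDart, opp_fst, ← hW.2.1] at this

/-- If the inner vertices of a leaf are not visited by the rest of a closed walk without
repeated states, the two parts share no edge. -/
theorem IsLeaf.edges_disjoint {L R : List (E × Bool)} {x : V × Bool} (hL : G.IsLeaf d x L)
    (hR : G.IsWalk d (opp x) R x) (hs : (G.states d (L ++ R)).Nodup)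
    (hin : ∀ v ∈ G.verts d L, v ∈ G.verts d R → v = x.1) :
    List.Disjoint (L.map Prod.fst) (R.map Prod.fst) := by
  rw [states_append] at hs
  intro e heL heR
  obtain ⟨a, ha, rfl⟩ := List.mem_map.1 heL
  obtain ⟨b, hb, hab⟩ := List.mem_map.1 heR
  have hxL : x ∈ G.states d L := hL.1.start_mem_states (hL.1.ne_nil (opp_ne x).symm)
  rcases eq_or_eq_revDart hab.symm with rfl | rfl
  · exact List.disjoint_of_nodup_append hs (mem_states_of_mem ha) (mem_states_of_mem hb)
  · have hav := mem_verts_of_mem_states (mem_states_of_mem (G := G) (d := d) ha)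
    have hbv := mem_verts_of_mem_states (mem_states_of_mem (G := G) (d := d) hb)
    have hsrc : (G.src d a).1 = x.1 := by
      rcases hR.tgt_mem hb with h | h
      · rw [tgt_revDart] at h
        have hv := mem_verts_of_mem_states (List.mem_of_mem_tail h)
        exact hin _ hav hv
      · rw [tgt_revDart] at h
        have hv := congrArg Prod.fst h
        exact hv
    have hsrc' : G.src d a = x :=
      List.inj_on_of_nodup_map hL.2 (mem_states_of_mem ha) hxL hsrc
    rw [src_revDart, opp_fst] at hbv
    have hb' := mem_states_of_mem (G := G) (d := d) hb
    rw [src_revDart] at hb'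
    rcases hL.1.tgt_mem ha with h | h
    · have h1 : G.tgt d a = x := List.inj_on_of_nodup_map hL.2 (List.mem_of_mem_tail h) hxL
        (hin _ (mem_verts_of_mem_states (List.mem_of_mem_tail h)) hbv)
      cases L with
      | nil => simp at ha
      | cons c L =>
        rw [h1, ← hL.1.1] at h
        exact (List.nodup_cons.1 (List.nodup_append.1 hs).1).1 h
    · rw [h, opp_opp] at hb'
      exact List.disjoint_of_nodup_append hs hxL hb'

theorem supp_mono {F F' : Finset E} (h : F ⊆ F') : G.supp F ⊆ G.supp F' :=
  fun _ ⟨e, he, hv⟩ => ⟨e, h he, hv⟩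

theorem adj_symm {F : Finset E} {v w : V} (h : G.adj F v w) : G.adj F w v := by
  obtain ⟨e, he, h⟩ := h
  exact ⟨e, he, h.symm⟩

theorem reach_symm {F : Finset E} {v w : V} (h : G.reach F v w) : G.reach F w v := by
  induction h with
  | refl => exact .refl
  | tail _ hbc ih => exact .head (adj_symm hbc) ih

theorem IsLeaf.ne_nil {L : List (E × Bool)} {x : V × Bool} (hL : G.IsLeaf d x L) : L ≠ [] :=
  hL.1.ne_nil (opp_ne x).symm

theorem IsLeaf.edges_nodup {L : List (E × Bool)} {x : V × Bool} (hL : G.IsLeaf d x L) :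
    (L.map Prod.fst).Nodup := hL.1.edges_nodup hL.2

theorem IsLeaf.mem_verts {L : List (E × Bool)} {x : V × Bool} (hL : G.IsLeaf d x L) :
    x.1 ∈ G.verts d L := mem_verts_of_mem_states (hL.1.start_mem_states hL.ne_nil)

variable (G d) in
theorem ends_eq_or (a : E × Bool) :
    ((G.ends a.1).1 = (G.src d a).1 ∧ (G.ends a.1).2 = (G.tgt d a).1) ∨
      ((G.ends a.1).2 = (G.src d a).1 ∧ (G.ends a.1).1 = (G.tgt d a).1) := by
  obtain ⟨e, b⟩ := a
  cases b <;> simp [src, tgt]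

end Walks

section Edges

variable {V E : Type} [DecidableEq E] {G : SignedMultigraph V E}
  {d : E → Bool × Bool}

/-- The set of edges used by `W`. -/
def edges (W : List (E × Bool)) : Finset E := (W.map Prod.fst).toFinset

/-- The number of times each edge is used by `W`. -/
def mult (W : List (E × Bool)) : E → ℚ := fun e => ((W.map Prod.fst).count e : ℚ)

theorem mem_edges {W : List (E × Bool)} {e : E} : e ∈ edges W ↔ e ∈ W.map Prod.fst :=
  List.mem_toFinset

theorem edges_append (A B : List (E × Bool)) : edges (A ++ B) = edges A ∪ edges B := by
  simp [edges]

theorem fst_mem_edges {W : List (E × Bool)} {a : E × Bool} (ha : a ∈ W) : a.1 ∈ edges W :=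
  mem_edges.2 (List.mem_map_of_mem ha)

@[simp] theorem mult_nil : mult ([] : List (E × Bool)) = 0 := by
  ext; simp [mult]

@[simp] theorem mult_append (A B : List (E × Bool)) : mult (A ++ B) = mult A + mult B := by
  ext; simp [mult]

@[simp] theorem mult_reverse (A : List (E × Bool)) :
    mult (A.map revDart).reverse = mult A := by
  ext e
  have h : (Prod.fst ∘ revDart : E × Bool → E) = Prod.fst := rfl
  simp [mult, h, List.map_reverse, List.count_reverse]

theorem mult_of_nodup {W : List (E × Bool)} (h : (W.map Prod.fst).Nodup) :
    mult W = fun e => if e ∈ edges W then (1 : ℚ) else 0 := by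
  ext e
  by_cases he : e ∈ W.map Prod.fst
  · rw [if_pos (mem_edges.2 he), mult, List.count_eq_one_of_mem h he, Nat.cast_one]
  · rw [if_neg (mt mem_edges.1 he), mult, List.count_eq_zero_of_not_mem he, Nat.cast_zero]

theorem mem_supp_edges {W : List (E × Bool)} {v : V} :
    v ∈ G.supp (edges W) ↔ ∃ a ∈ W, (G.src d a).1 = v ∨ (G.tgt d a).1 = v := by
  constructor
  · rintro ⟨e, he, h⟩
    obtain ⟨a, ha, rfl⟩ := List.mem_map.1 (mem_edges.1 he)
    refine ⟨a, ha, ?_⟩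
    rcases G.ends_eq_or d a with ⟨h1, h2⟩ | ⟨h1, h2⟩ <;> rw [h1, h2] at h
    exacts [h, h.symm]
  · rintro ⟨a, ha, h⟩
    refine ⟨a.1, fst_mem_edges ha, ?_⟩
    rcases G.ends_eq_or d a with ⟨h1, h2⟩ | ⟨h1, h2⟩ <;> rw [h1, h2]
    exacts [h, h.symm]

theorem IsWalk.mem_verts_of_mem_supp {W : List (E × Bool)} {x y : V × Bool}
    (hW : G.IsWalk d x W y) {v : V} (hv : v ∈ G.supp (edges W)) :
    v ∈ G.verts d W ∨ v = y.1 := by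
  obtain ⟨a, ha, rfl | rfl⟩ := (mem_supp_edges (d := d)).1 hv
  · exact Or.inl (mem_verts_of_mem_states (mem_states_of_mem ha))
  · rcases hW.tgt_mem ha with h | h
    · exact Or.inl (mem_verts_of_mem_states (List.mem_of_mem_tail h))
    · exact Or.inr (by rw [h])

theorem mem_supp_of_mem_verts {W : List (E × Bool)} {v : V} (hv : v ∈ G.verts d W) :
    v ∈ G.supp (edges W) := by
  obtain ⟨x, hx, rfl⟩ := exists_mem_states_of_mem_verts hv
  obtain ⟨a, ha, rfl⟩ := List.mem_map.1 hx
  exact mem_supp_edges.2 ⟨a, ha, Or.inl rfl⟩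

theorem adj_of_mem {W : List (E × Bool)} {a : E × Bool} (ha : a ∈ W) :
    G.adj (edges W) (G.src d a).1 (G.tgt d a).1 := by
  refine ⟨a.1, fst_mem_edges ha, ?_⟩
  rcases G.ends_eq_or d a with ⟨h1, h2⟩ | ⟨h1, h2⟩
  · exact Or.inl (Prod.ext h1 h2)
  · exact Or.inr (Prod.ext h2 h1)

theorem IsWalk.reach_of_subset {A W : List (E × Bool)} {x y : V × Bool}
    (hA : G.IsWalk d x A y) (hsub : A ⊆ W) {a : E × Bool} (ha : a ∈ A) :
    G.reach (edges W) x.1 (G.src d a).1 := by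
  induction A generalizing x with
  | nil => simp at ha
  | cons b A ih =>
    rw [← hA.1]
    rcases List.mem_cons.1 ha with rfl | ha
    · exact .refl
    · exact .head (adj_of_mem (hsub List.mem_cons_self))
        (ih hA.2 (fun c hc => hsub (List.mem_cons_of_mem _ hc)) ha)

theorem IsWalk.reach_supp {W : List (E × Bool)} {x y : V × Bool} (hW : G.IsWalk d x W y)
    {v w : V} (hv : v ∈ G.supp (edges W)) (hw : w ∈ G.supp (edges W)) :
    G.reach (edges W) v w := by
  have key : ∀ u ∈ G.supp (edges W), G.reach (edges W) x.1 u := by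
    intro u hu
    obtain ⟨a, ha, rfl | rfl⟩ := (mem_supp_edges (d := d)).1 hu
    · exact hW.reach_of_subset (List.Subset.refl _) ha
    · exact (hW.reach_of_subset (List.Subset.refl _) ha).tail (adj_of_mem ha)
  exact (reach_symm (key v hv)).trans (key w hw)

theorem noSourceSink_of_forall {W : List (E × Bool)}
    (h : ∀ v ∈ G.supp (edges W), ∃ s, (∃ a ∈ W, G.src d a = (v, s)) ∧
      ∃ b ∈ W, G.tgt d b = (v, s)) :
    G.NoSourceSink d (edges W) := by
  have hsrc : ∀ {a : E × Bool} {v : V} {s : Bool}, G.src d a = (v, s) →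
      ((G.ends a.1).1 = v ∧ (d a.1).1 = !s) ∨ ((G.ends a.1).2 = v ∧ (d a.1).2 = !s) := by
    rintro ⟨e, b⟩ v s hs
    cases b <;> simp only [src, Prod.mk.injEq, Bool.false_eq_true, if_true, if_false] at hs <;>
      simp [← hs.1, ← hs.2]
  have htgt : ∀ {a : E × Bool} {v : V} {s : Bool}, G.tgt d a = (v, s) →
      ((G.ends a.1).1 = v ∧ (d a.1).1 = s) ∨ ((G.ends a.1).2 = v ∧ (d a.1).2 = s) := by
    rintro ⟨e, b⟩ v s hs
    cases b <;> simp only [tgt, Prod.mk.injEq, Bool.false_eq_true, if_true, if_false] at hs <;>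
      simp [← hs.1, ← hs.2]
  intro v hv
  obtain ⟨s, ⟨a, ha, hav⟩, b, hb, hbv⟩ := h v hv
  have h1 := hsrc hav
  have h2 := htgt hbv
  cases s
  · exact ⟨⟨a.1, fst_mem_edges ha, h1⟩, b.1, fst_mem_edges hb, h2⟩
  · exact ⟨⟨b.1, fst_mem_edges hb, h2⟩, a.1, fst_mem_edges ha, h1⟩

theorem IsOrientation.even_neg_iff (hd : G.IsOrientation d) {W : List (E × Bool)}
    {x y : V × Bool} (hW : G.IsWalk d x W y) (hn : (W.map Prod.fst).Nodup) :
    Even (G.negEdges (edges W)).card ↔ x.2 = y.2 := by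
  have hcard : (G.negEdges (edges W)).card
      = ((W.map Prod.fst).filter (fun e => G.neg e)).length := by
    rw [← List.toFinset_card_of_nodup (hn.filter _), List.toFinset_filter]
    simp [negEdges, edges]
  rw [hcard]
  clear hcard hn
  induction W generalizing x with
  | nil => simp [show x = y from hW]
  | cons a W ih =>
    have h1 := hd a.1
    have h2 : (G.src d a).2 = (G.tgt d a).2 ↔ ¬ (d a.1).1 = (d a.1).2 := by
      obtain ⟨e, b⟩ := a
      cases b <;> cases h3 : (d e).1 <;> cases h4 : (d e).2 <;> simp [src, tgt, h3, h4]
    rw [← h1.not, hW.1] at h2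
    have h3 := ih hW.2
    rw [List.map_cons, List.filter_cons]
    cases hn : G.neg a.1
    · simp only [hn, Bool.false_eq_true, not_false_eq_true, iff_true, if_false] at h2 ⊢
      exact h3.trans (by rw [h2])
    · simp only [hn, not_true_eq_false, iff_false, if_true, List.length_cons] at h2 ⊢
      refine Nat.even_add_one.trans (h3.not.trans ?_)
      revert h2
      cases x.2 <;> cases y.2 <;> cases (G.tgt d a).2 <;> simp

theorem IsLeaf.mem_supp_iff {L : List (E × Bool)} {x : V × Bool} (hL : G.IsLeaf d x L)
    {v : V} : v ∈ G.supp (edges L) ↔ v ∈ G.verts d L := by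
  refine ⟨fun h => ?_, mem_supp_of_mem_verts⟩
  rcases hL.1.mem_verts_of_mem_supp h with h | rfl
  exacts [h, hL.mem_verts]

variable [DecidableEq V]

theorem IsWalk.degIn_edges {W : List (E × Bool)} {x y : V × Bool} (hW : G.IsWalk d x W y)
    (hn : (W.map Prod.fst).Nodup) (v : V) :
    G.degIn (edges W) v + (if x.1 = v then 1 else 0)
      = 2 * (G.verts d W).count v + (if y.1 = v then 1 else 0) := by
  unfold degIn edges
  rw [List.sum_toFinset _ hn]
  clear hn
  induction W generalizing x with
  | nil => simp [show x = y from hW]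
  | cons a W ih =>
    have h := ih hW.2
    have h2 : (if (G.ends a.1).1 = v then 1 else 0) + (if (G.ends a.1).2 = v then 1 else 0)
        = (if x.1 = v then 1 else 0) + (if (G.tgt d a).1 = v then 1 else 0) := by
      rw [← hW.1]
      rcases G.ends_eq_or d a with ⟨h1, h2⟩ | ⟨h1, h2⟩ <;> rw [h1, h2]
      rw [add_comm]
    rw [verts_cons, List.count_cons, hW.1]
    simp only [List.map_cons, List.sum_cons, beq_iff_eq] at h ⊢
    rw [h2]
    omega

theorem IsWalk.isCircuit {W : List (E × Bool)} {x y : V × Bool} (hW : G.IsWalk d x W y)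
    (hxy : x.1 = y.1) (hne : W ≠ []) (hv : (G.verts d W).Nodup) : G.IsCircuit (edges W) := by
  refine ⟨?_, fun v => ?_, fun v hv w hw => hW.reach_supp hv hw⟩
  · obtain ⟨a, ha⟩ := List.exists_mem_of_ne_nil W hne
    exact ⟨a.1, fst_mem_edges ha⟩
  · have h1 := hW.degIn_edges (hW.edges_nodup hv) v
    have h2 := List.nodup_iff_count_le_one.1 hv v
    rw [hxy] at h1
    omega

theorem IsLeaf.isUnbalancedCircuit (hd : G.IsOrientation d) {L : List (E × Bool)}
    {x : V × Bool} (hL : G.IsLeaf d x L) : G.IsUnbalancedCircuit (edges L) := by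
  refine ⟨hL.1.isCircuit rfl hL.ne_nil hL.2, ?_⟩
  rw [← Nat.not_even_iff_odd, hd.even_neg_iff hL.1 hL.edges_nodup]
  simp [opp]

/-- A walk that visits no vertex twice, its end included, traces a path. -/
theorem IsWalk.isPathBetween {W : List (E × Bool)} {x y : V × Bool} (hW : G.IsWalk d x W y)
    (hv : (G.verts d W ++ [y.1]).Nodup) : G.IsPathBetween (edges W) x.1 y.1 := by
  have hyW : y.1 ∉ G.verts d W := fun h =>
    List.disjoint_of_nodup_append hv h List.mem_cons_self
  have hv' : (G.verts d W).Nodup := hv.of_append_left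
  unfold IsPathBetween
  split_ifs with hxy
  · cases W with
    | nil => rfl
    | cons a W =>
      refine absurd ?_ hyW
      rw [← hxy, ← hW.1]
      exact List.mem_cons_self
  · have hW0 : W ≠ [] := hW.ne_nil (fun h => hxy (congrArg Prod.fst h))
    have hx := List.count_eq_one_of_mem hv'
      (mem_verts_of_mem_states (hW.start_mem_states hW0))
    have hy := List.count_eq_zero_of_not_mem hyW
    have hdeg := hW.degIn_edges (hW.edges_nodup hv')
    refine ⟨?_, ?_, fun v hvx hvy => ?_, fun v hv w hw => hW.reach_supp hv hw⟩
    · have := hdeg x.1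
      rw [if_pos rfl, if_neg (Ne.symm hxy), hx] at this
      omega
    · have := hdeg y.1
      rw [if_pos rfl, if_neg hxy, hy] at this
      omega
    · have := hdeg v
      rw [if_neg (Ne.symm hvx), if_neg (Ne.symm hvy)] at this
      have := List.nodup_iff_count_le_one.1 hv' v
      omega

end Edges

section CharacteristicFlows

variable {V E : Type} [DecidableEq E] {G : SignedMultigraph V E} {d : E → Bool × Bool}

theorem mult_perm {A B : List (E × Bool)} (h : A.Perm B) : mult A = mult B := by
  ext e
  simp only [mult, (h.map Prod.fst).count_eq]

/-- If a leaf of a closed walk shares an inner vertex with the rest of the walk, the closed walk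
can be recombined into two shorter ones. -/
theorem IsLeaf.eq_of_mem_verts {S : AddSubmonoid (E → ℚ)} {L R : List (E × Bool)}
    {x : V × Bool} (hL : G.IsLeaf d x L) (hR : G.IsWalk d (opp x) R x)
    (hs : (G.states d (L ++ R)).Nodup)
    (ih : ∀ Z z, G.IsWalk d z Z z → Z.length < (L ++ R).length → mult Z ∈ S)
    (hnot : mult (L ++ R) ∉ S) {v : V} (hvL : v ∈ G.verts d L) (hvR : v ∈ G.verts d R) :
    v = x.1 := by
  by_contra hv
  obtain ⟨A, B, z, rfl, hA, hB, rfl, -⟩ := hL.1.exists_split (List.mem_append_left _ hvL)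
  obtain ⟨C, D, w, rfl, hC, hD, hw, -⟩ := hR.exists_split (List.mem_append_left _ hvR)
  have hA0 : A ≠ [] := hA.ne_nil (by rintro rfl; exact hv rfl)
  have hB0 : B ≠ [] := hB.ne_nil (by rintro rfl; exact hv rfl)
  have hD0 : D ≠ [] := hD.ne_nil (by rintro rfl; exact hv hw.symm)
  have hzw : w ≠ z := by
    rintro rfl
    rw [states_append] at hs
    refine List.disjoint_of_nodup_append hs (a := w) ?_ ?_ <;> rw [states_append]
    · exact List.mem_append_right _ (hB.start_mem_states hB0)
    · exact List.mem_append_right _ (hD.start_mem_states hD0)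
  obtain rfl := eq_opp_of_ne hw hzw
  have hC' := hC.reverse
  have hD' := hD.reverse
  rw [opp_opp, opp_opp] at hC'
  rw [opp_opp] at hD'
  have hApos := List.length_pos_iff.2 hA0
  have hBpos := List.length_pos_iff.2 hB0
  have h1 := ih _ _ (hA.append hC') (by simp; omega)
  have h2 := ih _ _ (hB.append hD') (by simp; omega)
  refine hnot ?_
  have h3 := S.add_mem h1 h2
  simp only [mult_append, mult_reverse] at h3 ⊢
  convert h3 using 1
  abel

theorem IsLeaf.supp_inter {L R : List (E × Bool)} {x : V × Bool} (hL : G.IsLeaf d x L)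
    (hR : G.IsWalk d (opp x) R x)
    (hin : ∀ v ∈ G.verts d L, v ∈ G.verts d R → v = x.1) {F : Finset E} (hF : F ⊆ edges R) :
    (G.supp (edges L) \ {x.1}) ∩ G.supp F = ∅ := by
  ext v
  simp only [Set.mem_inter_iff, Set.mem_sdiff, Set.mem_singleton_iff, Set.mem_empty_iff_false,
    iff_false, not_and]
  rintro ⟨hvL, hvx⟩ hvF
  rcases hR.mem_verts_of_mem_supp (supp_mono hF hvF) with h | h
  · exact hvx (hin v (hL.mem_supp_iff.1 hvL) h)
  · exact hvx h

variable [DecidableEq V]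

variable (G d) in
/-- The characteristic flows of the signed circuits of `G` properly oriented by `d`. -/
def charFlows : Set (E → ℚ) :=
  {χ | (∃ C : Finset E, G.IsBalancedCircuit C ∧ G.NoSourceSink d C ∧
          χ = fun e => if e ∈ C then (1 : ℚ) else 0) ∨
        (∃ (C₁ C₂ P : Finset E) (v₁ v₂ : V),
          G.IsUnbalancedCircuit C₁ ∧ G.IsUnbalancedCircuit C₂ ∧
          G.IsPathBetween P v₁ v₂ ∧ v₁ ∈ G.supp C₁ ∧ v₂ ∈ G.supp C₂ ∧
          (G.supp C₁ \ {v₁}) ∩ G.supp (C₂ ∪ P) = ∅ ∧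
          (G.supp C₂ \ {v₂}) ∩ G.supp (C₁ ∪ P) = ∅ ∧
          G.NoSourceSink d (C₁ ∪ C₂ ∪ P) ∧
          χ = fun e => if e ∈ P then (1 : ℚ)
                         else if e ∈ C₁ ∪ C₂ then (1 / 2 : ℚ) else 0)}

theorem IsWalk.mult_mem_charFlows (hd : G.IsOrientation d) {W : List (E × Bool)}
    {x : V × Bool} (hW : G.IsWalk d x W x) (hne : W ≠ []) (hv : (G.verts d W).Nodup) :
    mult W ∈ G.charFlows d := by
  have hn := hW.edges_nodup hv
  refine Or.inl ⟨edges W, ⟨hW.isCircuit rfl hne hv, (hd.even_neg_iff hW hn).2 rfl⟩, ?_,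
    mult_of_nodup hn⟩
  refine noSourceSink_of_forall fun v hvW => ?_
  have hv' : v ∈ G.verts d W := by
    rcases hW.mem_verts_of_mem_supp hvW with h | rfl
    exacts [h, mem_verts_of_mem_states (hW.start_mem_states hne)]
  obtain ⟨y, hy, rfl⟩ := exists_mem_states_of_mem_verts hv'
  obtain ⟨a, ha, rfl⟩ := List.mem_map.1 hy
  refine ⟨(G.src d a).2, ⟨a, ha, rfl⟩, ?_⟩
  rw [Prod.mk.eta]
  rcases hW.src_mem ha with h | h
  · rw [h]
    exact hW.last_mem hne
  · exact h

/-- Two leaves joined by a path form a properly oriented barbell. -/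
theorem IsLeaf.barbell_mem_charFlows (hd : G.IsOrientation d) {L T L' T' : List (E × Bool)}
    {x y : V × Bool} (hL : G.IsLeaf d x L) (hT : G.IsWalk d (opp x) T y)
    (hL' : G.IsLeaf d y L') (hT' : G.IsWalk d (opp y) T' x)
    (hs : (G.states d (L ++ (T ++ L' ++ T'))).Nodup)
    (hin : ∀ v ∈ G.verts d L, v ∈ G.verts d (T ++ L' ++ T') → v = x.1)
    (hin' : ∀ v ∈ G.verts d L', v ∈ G.verts d (T' ++ L ++ T) → v = y.1)
    (hv : (G.verts d T ++ [y.1]).Nodup) :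
    (1 / 2 : ℚ) • mult L + mult T + (1 / 2 : ℚ) • mult L' ∈ G.charFlows d := by
  have hs' : (G.states d (L' ++ (T' ++ L ++ T))).Nodup := by
    refine (List.Perm.nodup_iff (List.Perm.map _ ?_)).1 hs
    have : L ++ (T ++ L' ++ T') = (L ++ T) ++ (L' ++ T') := by simp
    rw [this]
    refine List.perm_append_comm.trans ?_
    simp
  have hR := (hT.append hL'.1).append hT'
  have hR' := (hT'.append hL.1).append hT
  have hdis := hL.edges_disjoint hR hs hin
  have hdis' := hL'.edges_disjoint hR' hs' hin'
  have hTn := hT.edges_nodup hv.of_append_left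
  refine Or.inr ⟨edges L, edges L', edges T, x.1, y.1, hL.isUnbalancedCircuit hd,
    hL'.isUnbalancedCircuit hd, hT.isPathBetween hv, hL.mem_supp_iff.2 hL.mem_verts,
    hL'.mem_supp_iff.2 hL'.mem_verts, hL.supp_inter hR hin ?_, hL'.supp_inter hR' hin' ?_,
    ?_, ?_⟩
  · intro e
    simp only [edges_append, Finset.mem_union]
    tauto
  · intro e
    simp only [edges_append, Finset.mem_union]
    tauto
  · have hW := (hL.1.append hT).append hL'.1
    have hunion : edges L ∪ edges L' ∪ edges T = edges (L ++ T ++ L') := by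
      rw [edges_append, edges_append, Finset.union_right_comm]
    rw [hunion]
    refine noSourceSink_of_forall fun v hvW => ?_
    have hvW' : v ∈ G.verts d (L ++ T ++ L') := by
      rcases hW.mem_verts_of_mem_supp hvW with h | rfl
      · exact h
      · rw [verts_append]
        exact List.mem_append_right _ hL'.mem_verts
    obtain ⟨z, hz, rfl⟩ := exists_mem_states_of_mem_verts hvW'
    obtain ⟨a, ha, rfl⟩ := List.mem_map.1 hz
    rcases hW.src_mem ha with h | h
    · obtain ⟨b, hb, hbx⟩ := hL.1.last_mem hL.ne_nil
      obtain ⟨c, hc, hcx⟩ := (hT.append hL'.1).head_mem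
        (List.append_ne_nil_of_right_ne_nil _ hL'.ne_nil)
      rw [h]
      refine ⟨!x.2, ⟨c, ?_, hcx⟩, b, ?_, hbx⟩
      · rw [List.append_assoc]
        exact List.mem_append_right _ hc
      · exact List.mem_append_left _ (List.mem_append_left _ hb)
    · exact ⟨_, ⟨a, ha, rfl⟩, h⟩
  · rw [mult_of_nodup hL.edges_nodup, mult_of_nodup hL'.edges_nodup, mult_of_nodup hTn]
    ext e
    have h1 : e ∈ edges L → e ∉ edges T ∧ e ∉ edges L' := by
      intro he
      have := hdis (mem_edges.1 he)
      simp only [mem_edges, List.map_append, List.mem_append] at this ⊢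
      tauto
    have h2 : e ∈ edges L' → e ∉ edges T := by
      intro he
      have := hdis' (mem_edges.1 he)
      simp only [mem_edges, List.map_append, List.mem_append] at this ⊢
      tauto
    by_cases hT : e ∈ edges T
    · have hL : e ∉ edges L := fun h => (h1 h).1 hT
      have hL' : e ∉ edges L' := fun h => h2 h hT
      simp [hT, hL, hL']
    · by_cases hL : e ∈ edges L
      · simp [hT, hL, (h1 hL).2]
      · by_cases hL' : e ∈ edges L' <;> simp [hT, hL, hL']

/-- In a closed walk that is not a sum of characteristic flows although all shorter ones are,
a segment between two leaves, together with half of each leaf, is such a sum. -/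
theorem IsLeaf.segment_mem_closure (hd : G.IsOrientation d) {L T L' T' : List (E × Bool)}
    {x y : V × Bool} (hL : G.IsLeaf d x L) (hT : G.IsWalk d (opp x) T y)
    (hL' : G.IsLeaf d y L') (hT' : G.IsWalk d (opp y) T' x)
    (hs : (G.states d (L ++ (T ++ L' ++ T'))).Nodup)
    (ih : ∀ Z z, G.IsWalk d z Z z → Z.length < (L ++ (T ++ L' ++ T')).length →
      mult Z ∈ AddSubmonoid.closure (G.charFlows d))
    (hnot : mult (L ++ (T ++ L' ++ T')) ∉ AddSubmonoid.closure (G.charFlows d)) :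
    (1 / 2 : ℚ) • mult L + mult T + (1 / 2 : ℚ) • mult L' ∈
      AddSubmonoid.closure (G.charFlows d) := by
  by_cases hv : (G.verts d T ++ [y.1]).Nodup
  · have hperm : (L ++ (T ++ L' ++ T')).Perm (L' ++ (T' ++ L ++ T)) := by
      have : L ++ (T ++ L' ++ T') = (L ++ T) ++ (L' ++ T') := by simp
      rw [this]
      refine List.perm_append_comm.trans ?_
      simp
    refine AddSubmonoid.subset_closure (hL.barbell_mem_charFlows hd hT hL' hT' hs ?_ ?_ hv)
    · intro v hvL hvR
      exact hL.eq_of_mem_verts ((hT.append hL'.1).append hT') hs ih hnot hvL hvR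
    · intro v hvL hvR
      rw [mult_perm hperm] at hnot
      rw [hperm.length_eq] at ih
      exact hL'.eq_of_mem_verts ((hT'.append hL.1).append hT)
        ((hperm.map _).nodup_iff.1 hs) ih hnot hvL hvR
  · have hsT : (G.states d T ++ [y]).Nodup := by
      rw [states_append, states_append, states_append, List.append_assoc] at hs
      have h1 := hs.of_append_right
      rw [← List.append_assoc] at h1
      refine h1.of_append_left.sublist (List.Sublist.append_left ?_ _)
      exact List.singleton_sublist.2 (hL'.1.start_mem_states hL'.ne_nil)
    obtain ⟨P, M, Q, z, rfl, hP, hM, hQ⟩ := hT.exists_leaf hsT hv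
    have hpos := List.length_pos_iff.2 hM.ne_nil
    have heq : L ++ (P ++ M ++ Q ++ L' ++ T') = L ++ (P ++ M ++ (Q ++ L' ++ T')) := by simp
    have hperm : (L ++ (P ++ M ++ Q ++ L' ++ T')).Perm (M ++ (Q ++ L' ++ (T' ++ L ++ P))) := by
      have : L ++ (P ++ M ++ Q ++ L' ++ T') = (L ++ P) ++ (M ++ Q ++ L' ++ T') := by simp
      rw [this]
      refine List.perm_append_comm.trans ?_
      simp
    have h1 := hL.segment_mem_closure hd hP hM ((hQ.append hL'.1).append hT')
      (heq ▸ hs) (heq ▸ ih) (heq ▸ hnot)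
    have h2 := hM.segment_mem_closure hd hQ hL' ((hT'.append hL.1).append hP)
      ((hperm.map _).nodup_iff.1 hs) (hperm.length_eq ▸ ih) (mult_perm hperm ▸ hnot)
    convert AddSubmonoid.add_mem _ h1 h2 using 1
    simp only [mult_append]
    module
termination_by T.length
decreasing_by all_goals (subst_vars; simp only [List.length_append]; omega)

/-- Every closed walk is a sum of characteristic flows. -/
theorem IsWalk.mult_mem_closure (hd : G.IsOrientation d) {W : List (E × Bool)} {x : V × Bool}
    (hW : G.IsWalk d x W x) : mult W ∈ AddSubmonoid.closure (G.charFlows d) := by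
  induction hn : W.length using Nat.strong_induction_on generalizing W x with
  | _ n ih =>
    subst hn
    have ih' : ∀ Z z, G.IsWalk d z Z z → Z.length < W.length →
      mult Z ∈ AddSubmonoid.closure (G.charFlows d) := fun Z z hZ hlt => ih _ hlt hZ rfl
    clear ih
    by_contra hnot
    have hne : W ≠ [] := by
      rintro rfl
      exact hnot (by simp)
    by_cases hs : (G.states d W).Nodup
    swap
    · obtain ⟨A, B, C, z, rfl, hA, hB, hC, hB0, hC0⟩ := hW.exists_closed hs
      have hBpos := List.length_pos_iff.2 hB0
      have hCpos := List.length_pos_iff.2 hC0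
      have h1 := ih' _ _ hB (by simp; omega)
      have h2 := ih' _ _ (hA.append hC) (by simp; omega)
      refine hnot ?_
      convert AddSubmonoid.add_mem _ h1 h2 using 1
      simp only [mult_append]
      abel
    have hv : ¬ (G.verts d W).Nodup := fun hv =>
      hnot (AddSubmonoid.subset_closure (hW.mult_mem_charFlows hd hne hv))
    obtain ⟨W₀, l, rfl⟩ := (List.eq_nil_or_concat' W).resolve_left hne
    obtain ⟨w, hW₀, hl⟩ := hW.exists_of_append
    obtain ⟨P, M, Q, z, rfl, hP, hM, hQ⟩ := hW₀.exists_leaf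
      (by simpa [← hl.1] using hs) (by simpa [← hl.1] using hv)
    have hR := (hQ.append hl).append hP
    have hperm : (P ++ M ++ Q ++ [l]).Perm (M ++ (Q ++ [l] ++ P)) := by
      have : P ++ M ++ Q ++ [l] = P ++ (M ++ Q ++ [l]) := by simp
      rw [this]
      refine List.perm_append_comm.trans ?_
      simp
    rw [hperm.length_eq] at ih'
    rw [mult_perm hperm] at hnot
    have hs' : (G.states d (M ++ (Q ++ [l] ++ P))).Nodup := (hperm.map _).nodup_iff.1 hs
    generalize Q ++ [l] ++ P = R at hR ih' hnot hs'
    have hvR : ¬ (G.verts d R ++ [z.1]).Nodup := fun h =>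
      List.disjoint_of_nodup_append h
        (mem_verts_of_mem_states (hR.start_mem_states (hR.ne_nil (opp_ne z))))
        (List.mem_singleton_self _)
    have hsR : (G.states d R ++ [z]).Nodup := by
      rw [states_append] at hs'
      refine (List.nodup_append_comm.1 hs').sublist (List.Sublist.append_left ?_ _)
      exact List.singleton_sublist.2 (hM.1.start_mem_states hM.ne_nil)
    obtain ⟨A, N, B, u, rfl, hA, hN, hB⟩ := hR.exists_leaf hsR hvR
    have hperm' : (M ++ (A ++ N ++ B)).Perm (N ++ (B ++ M ++ A)) := by
      have : M ++ (A ++ N ++ B) = (M ++ A) ++ (N ++ B) := by simp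
      rw [this]
      refine List.perm_append_comm.trans ?_
      simp
    have h1 := hM.segment_mem_closure hd hA hN hB hs' ih' hnot
    have h2 := hN.segment_mem_closure hd hB hM hA ((hperm'.map _).nodup_iff.1 hs')
      (hperm'.length_eq ▸ ih') (mult_perm hperm' ▸ hnot)
    refine hnot ?_
    convert AddSubmonoid.add_mem _ h1 h2 using 1
    simp only [mult_append]
    module

end CharacteristicFlows

section Decomposition

variable {V E : Type} [DecidableEq V] {G : SignedMultigraph V E}
  {d : E → Bool × Bool}

/-- The signed indicator of the state `x`: `1` or `-1` at its vertex, according to its flag. -/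
def stateSign (x : V × Bool) (v : V) : ℤ :=
  if x.1 = v then (if x.2 then 1 else -1) else 0

theorem stateSign_dart (a : E × Bool) (v : V) :
    stateSign (G.tgt d a) v - stateSign (G.src d a) v
      = stateSign (G.ends a.1 |>.1, (d a.1).1) v + stateSign (G.ends a.1 |>.2, (d a.1).2) v := by
  obtain ⟨e, b⟩ := a
  cases b <;> cases h1 : (d e).1 <;> cases h2 : (d e).2 <;>
    simp only [stateSign, src, tgt, h1, h2, Bool.not_true, Bool.not_false, Bool.false_eq_true,
      if_true, if_false] <;> split_ifs <;> rfl

variable [Fintype E]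

theorem vertexSum_eq (ψ : E → ℤ) (v : V) :
    G.vertexSum d ψ v = ∑ e, ψ e *
      (stateSign (G.ends e |>.1, (d e).1) v + stateSign (G.ends e |>.2, (d e).2) v) := by
  refine Finset.sum_congr rfl fun e _ => ?_
  simp only [stateSign]
  split_ifs <;> ring

/-- A nonnegative function whose excess is concentrated on the states `x ≠ y` has a dart of its
support leaving `y`. -/
theorem exists_dart_src_eq {ψ : E → ℤ} (hψ : ∀ e, 0 ≤ ψ e) {x y : V × Bool} (hxy : x ≠ y)
    (h : ∀ v, G.vertexSum d ψ v = stateSign x v - stateSign y v) :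
    ∃ a : E × Bool, G.src d a = y ∧ 0 < ψ a.1 := by
  by_contra! hcon
  have key : ∀ e s, (G.ends e |>.1, !(d e).1) = y ∨ (G.ends e |>.2, !(d e).2) = y →
      ψ e * s = 0 := by
    rintro e s (he | he)
    · rw [le_antisymm (hcon (e, false) he) (hψ e), zero_mul]
    · rw [le_antisymm (hcon (e, true) he) (hψ e), zero_mul]
  have hy := h y.1
  rw [vertexSum_eq] at hy
  obtain ⟨u, t⟩ := y
  have hsign : ∀ z : V × Bool, (z.1, !z.2) ≠ (u, t) →
      0 ≤ (if t then 1 else -1) * stateSign z u := by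
    rintro ⟨w, s⟩ hz
    unfold stateSign
    by_cases hw : w = u
    · subst hw
      cases s <;> cases t <;> simp at hz ⊢
    · simp [hw]
  have hnonneg : 0 ≤ (if t then 1 else -1) * ∑ e, ψ e *
      (stateSign (G.ends e |>.1, (d e).1) u + stateSign (G.ends e |>.2, (d e).2) u) := by
    rw [Finset.mul_sum]
    refine Finset.sum_nonneg fun e _ => ?_
    by_cases he : (G.ends e |>.1, !(d e).1) = (u, t) ∨ (G.ends e |>.2, !(d e).2) = (u, t)
    · rw [key e _ he, mul_zero]
    · rw [not_or] at he
      have h1 := hsign (G.ends e |>.1, (d e).1) he.1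
      have h2 := hsign (G.ends e |>.2, (d e).2) he.2
      have h3 := mul_nonneg (hψ e) (add_nonneg h1 h2)
      linarith
  rw [hy] at hnonneg
  obtain ⟨w, s⟩ := x
  simp only [stateSign, if_true] at hnonneg
  by_cases hw : w = u
  · subst hw
    cases s <;> cases t <;> simp at hxy hnonneg
  · cases s <;> cases t <;> simp [hw] at hnonneg

variable [DecidableEq E]

theorem vertexSum_sub_single (ψ : E → ℤ) (a : E × Bool) (v : V) :
    G.vertexSum d (ψ - Pi.single a.1 1) v
      = G.vertexSum d ψ v - (stateSign (G.tgt d a) v - stateSign (G.src d a) v) := by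
  simp only [vertexSum_eq, stateSign_dart, Pi.sub_apply, sub_mul, Finset.sum_sub_distrib]
  congr 1
  rw [Finset.sum_eq_single a.1]
  · simp
  · intro e _ he
    simp [Pi.single_eq_of_ne he]
  · simp

/-- A nonnegative function whose excess is concentrated on the states `x` and `y` is a walk from
`y` to `x` plus a sum of characteristic flows. -/
theorem exists_walk_add_mem_closure (hd : G.IsOrientation d) {ψ : E → ℤ} (hψ : ∀ e, 0 ≤ ψ e)
    {x y : V × Bool} (h : ∀ v, G.vertexSum d ψ v = stateSign x v - stateSign y v) :
    ∃ W, G.IsWalk d y W x ∧ ∃ f ∈ AddSubmonoid.closure (G.charFlows d),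
      (fun e => (ψ e : ℚ)) = mult W + f := by
  induction hn : (∑ e, ψ e).toNat using Nat.strong_induction_on generalizing ψ x y with
  | _ n ih =>
    subst hn
    have step : ∀ a : E × Bool, 0 < ψ a.1 → ∀ x' y' : V × Bool,
        (∀ v, G.vertexSum d ψ v - (stateSign (G.tgt d a) v - stateSign (G.src d a) v)
          = stateSign x' v - stateSign y' v) →
        ∃ W, G.IsWalk d y' W x' ∧ ∃ f ∈ AddSubmonoid.closure (G.charFlows d),
          (fun e => (ψ e : ℚ)) = mult (a :: W) + f := by
      intro a ha x' y' h'
      have hpos : 0 < ∑ e, ψ e :=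
        Finset.sum_pos' (fun e _ => hψ e) ⟨a.1, Finset.mem_univ _, ha⟩
      have hsum : ∑ e, (ψ - Pi.single a.1 1 : E → ℤ) e = ∑ e, ψ e - 1 := by
        simp [Finset.sum_sub_distrib]
      obtain ⟨W, hW, f, hf, heq⟩ := ih _ (by rw [hsum]; omega)
        (ψ := ψ - Pi.single a.1 1) (fun e => by
          by_cases he : e = a.1
          · subst he
            simp
            omega
          · simp [Pi.single_eq_of_ne he, hψ e])
        (fun v => (vertexSum_sub_single ψ a v).trans (h' v)) rfl
      refine ⟨W, hW, f, hf, ?_⟩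
      ext e
      have he := congrFun heq e
      simp only [Pi.sub_apply, Pi.add_apply, mult, List.map_cons, List.count_cons, beq_iff_eq,
        Nat.cast_add] at he ⊢
      by_cases hea : e = a.1
      · subst hea
        simp at he ⊢
        linarith
      · simp [Ne.symm hea] at he ⊢
        exact he
    by_cases hxy : x = y
    · subst hxy
      refine ⟨[], rfl, _, ?_, (by rw [mult_nil, zero_add])⟩
      by_cases h0 : ∃ e, ψ e ≠ 0
      · obtain ⟨e, he⟩ := h0
        obtain ⟨W, hW, f, hf, heq⟩ := step (e, false) (lt_of_le_of_ne (hψ e) he.symm)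
          (G.src d (e, false)) (G.tgt d (e, false)) (fun v => by rw [h v]; ring)
        rw [heq]
        have hclosed : G.IsWalk d (G.src d (e, false)) ((e, false) :: W) (G.src d (e, false)) :=
          ⟨rfl, hW⟩
        exact AddSubmonoid.add_mem _ (hclosed.mult_mem_closure hd) hf
      · push Not at h0
        have : (fun e => (ψ e : ℚ)) = 0 := by
          ext e
          simp [h0 e]
        rw [this]
        exact AddSubmonoid.zero_mem _
    · obtain ⟨a, rfl, ha⟩ := exists_dart_src_eq hψ hxy h
      obtain ⟨W, hW, f, hf, heq⟩ := step a ha x (G.tgt d a) (fun v => by rw [h v]; ring)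
      exact ⟨a :: W, ⟨rfl, hW⟩, f, hf, heq⟩

end Decomposition

end SignedMultigraph

open SignedMultigraph in
/-- Máčajová–Škoviera: every nonnegative integer flow on a signed graph is a positive
integer combination of characteristic flows of (properly oriented) signed circuits. -/
theorem stmt_19 {V E : Type} [Fintype V] [Fintype E] [DecidableEq V] [DecidableEq E]
    (G : SignedMultigraph V E) (d : E → Bool × Bool) (φ : E → ℤ)
    (hflow : G.IsFlow d φ) (hnn : ∀ e, 0 ≤ φ e) :
    ∃ (m : ℕ) (α : Fin m → ℤ) (χ : Fin m → E → ℚ),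
      (∀ i, 0 < α i) ∧
      (∀ i,
        (∃ C : Finset E, G.IsBalancedCircuit C ∧ G.NoSourceSink d C ∧
          χ i = fun e => if e ∈ C then (1 : ℚ) else 0) ∨
        (∃ (C₁ C₂ P : Finset E) (v₁ v₂ : V),
          G.IsUnbalancedCircuit C₁ ∧ G.IsUnbalancedCircuit C₂ ∧
          G.IsPathBetween P v₁ v₂ ∧ v₁ ∈ G.supp C₁ ∧ v₂ ∈ G.supp C₂ ∧
          (G.supp C₁ \ {v₁}) ∩ G.supp (C₂ ∪ P) = ∅ ∧
          (G.supp C₂ \ {v₂}) ∩ G.supp (C₁ ∪ P) = ∅ ∧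
          G.NoSourceSink d (C₁ ∪ C₂ ∪ P) ∧
          χ i = fun e => if e ∈ P then (1 : ℚ)
                         else if e ∈ C₁ ∪ C₂ then (1 / 2 : ℚ) else 0)) ∧
      ∀ e : E, (φ e : ℚ) = ∑ i, (α i : ℚ) * χ i e := by
  have hmem : (fun e => (φ e : ℚ)) ∈ AddSubmonoid.closure (G.charFlows d) := by
    cases isEmpty_or_nonempty V with
    | inl hV =>
      have hE : IsEmpty E := ⟨fun e => hV.false (G.ends e).1⟩
      rw [Subsingleton.elim (fun e => (φ e : ℚ)) 0]
      exact AddSubmonoid.zero_mem _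
    | inr hV =>
      obtain ⟨v⟩ := hV
      obtain ⟨W, hW, f, hf, heq⟩ := exists_walk_add_mem_closure (x := (v, true))
        (y := (v, true)) hflow.1 hnn (fun w => by rw [hflow.2 w, sub_self])
      rw [heq]
      exact AddSubmonoid.add_mem _ (hW.mult_mem_closure hflow.1) hf
  obtain ⟨l, hl, hsum⟩ := AddSubmonoid.exists_list_of_mem_closure hmem
  refine ⟨l.length, fun _ => 1, fun i => l[i], fun _ => one_pos,
    fun i => hl _ (List.getElem_mem i.2), fun e => ?_⟩
  have h := congrFun hsum e
  rw [← Fin.sum_univ_getElem, Finset.sum_apply] at h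
  simpa using h.symm
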